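/- arXiv:1311.6331 — 2 statements merged into one kernel-verified Lean document; each statement's English description precedes it below -/
import Mathlib

section
/- Let s : [0, 2π] → ℝ³ be a continuous map with s(0) = s(2π) that is injective on [0, 2π), and suppose s has finite total variation V = Var(s; [0, 2π]) (the curve is rectifiable). For 0 ≤ φ₁ ≤ φ₂ ≤ 2π, let λ(φ₁, φ₂) = Var(s; [φ₁, φ₂]) and ρ(φ₁, φ₂) = min(λ(φ₁, φ₂), V − λ(φ₁, φ₂)). Then for every δ > 0 there exists ε > 0 such that for all φ₁ ≤ φ₂ in [0, 2π], if ‖s(φ₁) − s(φ₂)‖ < ε then ρ(φ₁, φ₂) < δ. -/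
open scoped Real

theorem BoundedVariationOn.continuousOn_variationOnFromTo {α E : Type*} [LinearOrder α]
    [TopologicalSpace α] [OrderTopology α] [PseudoEMetricSpace E] {f : α → E} {t : Set α} {a : α}
    (hf : BoundedVariationOn f t) (hc : ContinuousOn f t) (ha : a ∈ t) :
    ContinuousOn (variationOnFromTo f t a) t := by
  intro x hx
  have hr := (ENNReal.tendsto_toReal ENNReal.zero_ne_top).comp
    (hf.tendsto_eVariationOn_Icc_zero_right x ((hc x hx).mono Set.inter_subset_left))
  have hl := (ENNReal.tendsto_toReal ENNReal.zero_ne_top).comp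
    (hf.tendsto_eVariationOn_Icc_zero_left ((hc x hx).mono Set.inter_subset_left))
  have h := (hr.sub hl).const_add (variationOnFromTo f t a x)
  simp only [ENNReal.toReal_zero, sub_zero, add_zero] at h
  refine h.congr' ?_
  filter_upwards [self_mem_nhdsWithin] with y hy
  rw [← variationOnFromTo.add hf.locallyBoundedVariationOn ha hx hy]
  congr 1
  rcases le_total x y with hxy | hyx
  · rw [variationOnFromTo.eq_of_le _ _ hxy, Function.comp_apply, Function.comp_apply,
      eVariationOn.subsingleton f (s := t ∩ Set.Icc y x) (by grind [Set.Subsingleton])]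
    simp
  · rw [variationOnFromTo.eq_of_ge _ _ hyx, Function.comp_apply, Function.comp_apply,
      eVariationOn.subsingleton f (s := t ∩ Set.Icc x y) (by grind [Set.Subsingleton])]
    simp

theorem stmt8 (s : ℝ → EuclideanSpace ℝ (Fin 3))
    (hcont : ContinuousOn s (Set.Icc 0 (2 * π)))
    (hclosed : s 0 = s (2 * π))
    (hinj : Set.InjOn s (Set.Ico 0 (2 * π)))
    (hrect : eVariationOn s (Set.Icc 0 (2 * π)) ≠ ⊤) :
    ∀ δ > (0 : ℝ), ∃ ε > (0 : ℝ), ∀ φ₁ φ₂ : ℝ,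
      0 ≤ φ₁ → φ₁ ≤ φ₂ → φ₂ ≤ 2 * π →
      ‖s φ₁ - s φ₂‖ < ε →
      min ((eVariationOn s (Set.Icc φ₁ φ₂)).toReal)
        ((eVariationOn s (Set.Icc 0 (2 * π))).toReal
          - (eVariationOn s (Set.Icc φ₁ φ₂)).toReal) < δ := by
  intro δ hδ
  set I := Set.Icc 0 (2 * π) with hI
  have h0 : (0 : ℝ) ∈ I := ⟨le_rfl, by positivity⟩
  set L := variationOnFromTo s I 0
  have hL : ContinuousOn L I := BoundedVariationOn.continuousOn_variationOnFromTo hrect hcont h0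
  have hvar : ∀ a b, 0 ≤ a → a ≤ b → b ≤ 2 * π →
      (eVariationOn s (Set.Icc a b)).toReal = L b - L a := by
    intro a b ha hab hb
    have hrect' : BoundedVariationOn s I := hrect
    rw [variationOnFromTo.sub_right hrect'.locallyBoundedVariationOn h0 ⟨ha.trans hab, hb⟩
      ⟨ha, hab.trans hb⟩, variationOnFromTo.eq_of_le _ _ hab,
      Set.inter_eq_right.2 (Set.Icc_subset_Icc ha hb)]
  set V := (eVariationOn s I).toReal
  let ρ : ℝ × ℝ → ℝ := fun p ↦ min (L p.2 - L p.1) (V - (L p.2 - L p.1))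
  have hfst : ContinuousOn (fun p : ℝ × ℝ ↦ L p.1) (I ×ˢ I) :=
    hL.comp continuousOn_fst fun p hp ↦ hp.1
  have hsnd : ContinuousOn (fun p : ℝ × ℝ ↦ L p.2) (I ×ˢ I) :=
    hL.comp continuousOn_snd fun p hp ↦ hp.2
  have hρ : ContinuousOn ρ (I ×ˢ I) :=
    ContinuousOn.inf (hsnd.sub hfst) (continuousOn_const.sub (hsnd.sub hfst))
  have hdist : ContinuousOn (fun p : ℝ × ℝ ↦ ‖s p.1 - s p.2‖) (I ×ˢ I) :=
    ((hcont.comp continuousOn_fst fun p hp ↦ hp.1).sub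
      (hcont.comp continuousOn_snd fun p hp ↦ hp.2)).norm
  have hII : IsCompact (I ×ˢ I) := isCompact_Icc.prod isCompact_Icc
  let K := ((I ×ˢ I) ∩ ρ ⁻¹' Set.Ici δ) ∩ {p | p.1 ≤ p.2}
  have hK : IsCompact K :=
    (hII.of_isClosed_subset (hρ.preimage_isClosed_of_isClosed hII.isClosed isClosed_Ici)
      Set.inter_subset_left).inter_right (isClosed_le continuous_fst continuous_snd)
  have hpos : ∀ p ∈ K, 0 < ‖s p.1 - s p.2‖ := by
    rintro ⟨a, b⟩ ⟨⟨⟨ha, hb⟩, hab⟩, hle⟩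
    simp only [Set.mem_preimage, Set.mem_Ici, ρ, le_min_iff] at hab hle ha hb
    simp only [Set.mem_ofPred_eq] at hle
    rw [norm_pos_iff, sub_ne_zero]
    intro heq
    have hne : a ≠ b := by
      rintro rfl
      linarith [hab.1]
    have hlt := lt_of_le_of_ne hle hne
    rcases hb.2.lt_or_eq with hb2 | rfl
    · exact hne (hinj ⟨ha.1, hlt.trans hb2⟩ ⟨hb.1, hb2⟩ heq)
    · have ha0 : a = 0 :=
        hinj ⟨ha.1, hlt⟩ ⟨le_rfl, ha.1.trans_lt hlt⟩ (heq.trans hclosed.symm)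
      subst ha0
      have hV := hvar 0 (2 * π) le_rfl hle le_rfl
      linarith [hab.2]
  obtain ⟨ε, hε, hεK⟩ : ∃ ε > 0, ∀ p ∈ K, ε ≤ ‖s p.1 - s p.2‖ := by
    rcases K.eq_empty_or_nonempty with hemp | hne
    · exact ⟨1, one_pos, by simp [hemp]⟩
    · obtain ⟨p, hp, hmin⟩ := hK.exists_isMinOn hne
        (hdist.mono (Set.inter_subset_left.trans Set.inter_subset_left))
      exact ⟨_, hpos p hp, fun q hq ↦ hmin hq⟩
  refine ⟨ε, hε, fun a b ha hab hb hlt ↦ ?_⟩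
  rw [hvar a b ha hab hb]
  by_contra! hge
  exact (hεK (a, b) ⟨⟨⟨⟨ha, hab.trans hb⟩, ⟨ha.trans hab, hb⟩⟩, hge⟩, hab⟩).not_gt hlt
end

section
/- Let f̂ : ℝ³ → ℝ be continuous with f̂(x) = 2 whenever ‖x‖ ≥ 3/2, let B̂ = {x : f̂(x) ≤ 1}, and assume 0 lies in the interior of B̂ and that the interior of B̂ equals {x : f̂(x) < 1}. Then for every ε > 0 there exists δ > 0 such that for every continuous f : ℝ³ → ℝ with |f(x) − f̂(x)| < δ for all x, and every a ∈ ℝ³ with ‖a‖ < δ, the frontier of the set {x : f(x − a) ≤ 1} is contained in the closed ε-thickening of the frontier of B̂, i.e. in {x : dist(x, ∂B̂) ≤ ε}. -/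
theorem stmt11 (fhat : EuclideanSpace ℝ (Fin 3) → ℝ)
    (hfhat : Continuous fhat)
    (hfar : ∀ x : EuclideanSpace ℝ (Fin 3), (3 : ℝ) / 2 ≤ ‖x‖ → fhat x = 2)
    (Bhat : Set (EuclideanSpace ℝ (Fin 3)))
    (hBhat : Bhat = {x | fhat x ≤ 1})
    (h0 : (0 : EuclideanSpace ℝ (Fin 3)) ∈ interior Bhat)
    (hintB : interior Bhat = {x | fhat x < 1}) :
    ∀ ε > (0 : ℝ), ∃ δ > (0 : ℝ),
      ∀ f : EuclideanSpace ℝ (Fin 3) → ℝ, Continuous f →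
        (∀ x, |f x - fhat x| < δ) →
        ∀ a : EuclideanSpace ℝ (Fin 3), ‖a‖ < δ →
          frontier {x | f (x - a) ≤ 1} ⊆ Metric.cthickening ε (frontier Bhat) := by
  intro ε hε
  have hfr : ∀ x, fhat x = 1 → x ∈ frontier Bhat := by
    intro x hx
    refine ⟨subset_closure ?_, ?_⟩
    · rw [hBhat]
      exact hx.le
    · rw [hintB]
      exact fun h => (ne_of_lt h) hx
  have hK : IsCompact (Metric.closedBall (0 : EuclideanSpace ℝ (Fin 3)) (3 / 2) \
      Metric.thickening (ε / 2) (frontier Bhat)) :=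
    (isCompact_closedBall _ _).diff Metric.isOpen_thickening
  obtain ⟨m, hm, hmK⟩ := hK.exists_forall_le' (f := fun x => |fhat x - 1|) (a := 0)
    (by fun_prop) (by
      intro x hx
      refine abs_pos.mpr fun h => hx.2 ?_
      exact Metric.self_subset_thickening (half_pos hε) _ (hfr x (sub_eq_zero.mp h)))
  refine ⟨min m (min 1 (ε / 2)), by positivity, ?_⟩
  intro f hf hclose a ha x hx
  simp only [lt_min_iff] at hclose ha
  have hx1 : f (x - a) = 1 :=
    frontier_le_subset_eq (hf.comp (continuous_id.sub continuous_const)) continuous_const hx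
  obtain ⟨h1, h2, -⟩ := hclose (x - a)
  rw [hx1, abs_sub_comm] at h1 h2
  have hnorm : ‖x - a‖ ≤ 3 / 2 := by
    by_contra! h
    rw [hfar _ h.le] at h2
    norm_num at h2
  have hthick : x - a ∈ Metric.thickening (ε / 2) (frontier Bhat) := by
    by_contra h
    exact (hmK (x - a) ⟨by simpa using hnorm, h⟩).not_gt h1
  obtain ⟨z, hz, hdist⟩ := Metric.mem_thickening_iff.mp hthick
  refine Metric.mem_cthickening_of_dist_le x z ε _ hz ?_
  have hxa : dist x (x - a) = ‖a‖ := by simp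
  linarith [dist_triangle x (x - a) z, ha.2.2]
end
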